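/- For every field 𝔽 there exists a constant c > 0 such that, asymptotically almost surely, the minimum rank over 𝔽 of a fooling-set pattern Q(n) drawn uniformly at random from all fooling-set patterns of size n is at least c·n. -/

import Mathlib

open Filter

/-- A fooling-set pattern: `1`s on the diagonal, and at least one of every pair of
diagonally opposite off-diagonal entries is `0`. -/
def IsFoolingPattern {n : ℕ} (R : Matrix (Fin n) (Fin n) Bool) : Prop :=
  (∀ k, R k k = true) ∧ ∀ k ℓ, k ≠ ℓ → (R k ℓ = false ∨ R ℓ k = false)

/-- Number of off-diagonal `1`-entries of a pattern. -/
noncomputable def offDiagOnes {n : ℕ} (R : Matrix (Fin n) (Fin n) Bool) : ℕ :=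
  Nat.card {q : Fin n × Fin n // q.1 ≠ q.2 ∧ R q.1 q.2 = true}

/-- `R` has density `p`: exactly `⌈p·C(n,2)⌉` off-diagonal `1`-entries. -/
def HasDensity {n : ℕ} (R : Matrix (Fin n) (Fin n) Bool) (p : ℝ) : Prop :=
  offDiagOnes R = ⌈p * (n.choose 2 : ℝ)⌉₊

/-- Minimum rank over `𝔽` of a matrix with zero-nonzero pattern `R`. -/
noncomputable def minRank (𝔽 : Type*) [Field 𝔽] {n : ℕ}
    (R : Matrix (Fin n) (Fin n) Bool) : ℕ :=
  sInf {r | ∃ M : Matrix (Fin n) (Fin n) 𝔽,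
    (∀ k ℓ, M k ℓ ≠ 0 ↔ R k ℓ = true) ∧ M.rank = r}

theorem Nat.choose_add_mul_nine_pow_le (N D : ℕ) :
    (N + D).choose D * 9 ^ D ≤ 10 ^ (N + D) := by
  have h := add_pow (9 : ℕ) 1 (N + D)
  have h2 := Finset.single_le_sum (f := fun m => 9 ^ m * 1 ^ (N + D - m) * (N + D).choose m)
    (fun i _ => Nat.zero_le _) (Finset.mem_range.2 (show D < N + D + 1 by omega))
  simp only [Nat.cast_id] at h
  rw [← h] at h2
  simpa [mul_comm] using h2

theorem MvPolynomial.finrank_restrictTotalDegree_le (σ F : Type*) [Fintype σ] [Field F] (D : ℕ) :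
    Module.finrank F (restrictTotalDegree σ F D) ≤ (Fintype.card σ + D).choose D := by
  classical
  rw [restrictTotalDegree, Module.finrank_eq_nat_card_basis (basisRestrictSupport F _),
    Nat.card_coe_set_eq]
  have hcard := Finset.card_finsuppAntidiag_nat_eq_choose
    (s := (Finset.univ : Finset (Option σ))) D
  simp only [Finset.card_univ, Fintype.card_option] at hcard
  rw [show Fintype.card σ + 1 + D - 1 = Fintype.card σ + D by omega] at hcard
  rw [← hcard]
  refine le_trans ?_ (Finset.card_image_le (f := fun g : Option σ →₀ ℕ => g.some))
  rw [← Set.ncard_coe_finset]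
  refine Set.ncard_le_ncard ?_ (Finset.finite_toSet _)
  intro d hd
  simp only [Set.mem_ofPred_eq] at hd
  rw [Finsupp.sum_fintype _ _ (by simp)] at hd
  simp only [Finset.coe_image, Set.mem_image, Finset.mem_coe, Finset.mem_finsuppAntidiag]
  refine ⟨Finsupp.optionElim (D - ∑ i, d i) d, ⟨?_, Finset.subset_univ _⟩, ?_⟩
  · simp [Fintype.sum_option]; omega
  · ext i; simp

theorem Matrix.exists_eq_mul_of_rank_le {F m n : Type*} [Field F] [Fintype m] [Fintype n]
    (M : Matrix m n F) {r : ℕ} (h : M.rank ≤ r) :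
    ∃ (A : Matrix m (Fin r) F) (B : Matrix (Fin r) n F), M = A * B := by
  classical
  obtain ⟨g, hg⟩ := (finrank_le_iff_exists_linearMap (R := F)
    (M := LinearMap.range M.mulVecLin) (M' := Fin r → F)).1 (by simpa [Matrix.rank] using h)
  obtain ⟨k, hk⟩ := g.exists_leftInverse_of_injective (LinearMap.ker_eq_bot.2 hg)
  refine ⟨LinearMap.toMatrix' ((LinearMap.range M.mulVecLin).subtype ∘ₗ k),
    LinearMap.toMatrix' (g ∘ₗ M.mulVecLin.rangeRestrict), ?_⟩
  rw [← LinearMap.toMatrix'_comp, LinearMap.comp_assoc, ← LinearMap.comp_assoc _ g k, hk,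
    LinearMap.id_comp, show (LinearMap.range M.mulVecLin).subtype ∘ₗ M.mulVecLin.rangeRestrict =
      M.mulVecLin from rfl, ← Matrix.toLin'_apply', LinearMap.toMatrix'_toLin']

/-- The Rónyai–Babai–Ganapathy bound on the number of zero-nonzero patterns realised by a finite
family of polynomials of bounded total degree. -/
theorem MvPolynomial.card_le_of_support_injective {σ F κ ι : Type*} [Fintype σ] [Field F]
    [Fintype κ] [Fintype ι] (f : κ → MvPolynomial σ F) {d : ℕ}
    (hf : ∀ k, (f k).totalDegree ≤ d) (S : ι → Finset κ) (hS : Function.Injective S)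
    (x : ι → σ → F) (hx : ∀ i k, eval (x i) (f k) ≠ 0 ↔ k ∈ S i) :
    Fintype.card ι ≤
      (Fintype.card σ + Fintype.card κ * d).choose (Fintype.card κ * d) := by
  classical
  have hdeg : ∀ i, ∏ k ∈ S i, f k ∈ restrictTotalDegree σ F (Fintype.card κ * d) := by
    intro i
    rw [mem_restrictTotalDegree]
    refine (totalDegree_finsetProd _ _).trans ((Finset.sum_le_card_nsmul _ _ d
      fun k _ => hf k).trans ?_)
    rw [smul_eq_mul]
    exact Nat.mul_le_mul_right _ (Finset.card_le_univ _)
  have heval : ∀ i j, eval (x i) (∏ k ∈ S j, f k) ≠ 0 ↔ S j ⊆ S i := by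
    intro i j
    rw [map_prod, Finset.prod_ne_zero_iff]
    exact forall₂_congr fun k _ => hx i k
  have hli : LinearIndependent F
      (fun i => (⟨∏ k ∈ S i, f k, hdeg i⟩ : restrictTotalDegree σ F (Fintype.card κ * d))) := by
    rw [Fintype.linearIndependent_iff]
    intro c hc
    by_contra! hne
    obtain ⟨i, hi, hmin⟩ := Finset.exists_min_image (Finset.univ.filter fun i => c i ≠ 0)
      (fun i => (S i).card) (by obtain ⟨i, hi⟩ := hne; exact ⟨i, by simpa using hi⟩)
    simp only [Finset.mem_filter, Finset.mem_univ, true_and] at hi hmin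
    have hc' := congrArg (fun p : restrictTotalDegree σ F (Fintype.card κ * d) =>
      eval (x i) (p : MvPolynomial σ F)) hc
    simp only [Submodule.coe_sum, Submodule.coe_smul, map_sum, smul_eval, Submodule.coe_zero,
      map_zero] at hc'
    rw [Finset.sum_eq_single i] at hc'
    · exact mul_ne_zero hi ((heval i i).2 subset_rfl) hc'
    · intro j _ hji
      by_cases hj : c j = 0
      · simp [hj]
      by_contra hz
      have hsub := (heval i j).1 (right_ne_zero_of_mul hz)
      exact hji (hS (Finset.eq_of_subset_of_card_le hsub (hmin j hj)))
    · simp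
  exact hli.fintype_card_le_finrank.trans (finrank_restrictTotalDegree_le _ _ _)

theorem exists_pattern_rank_eq_minRank {𝔽 : Type*} [Field 𝔽] {n : ℕ}
    (R : Matrix (Fin n) (Fin n) Bool) :
    ∃ M : Matrix (Fin n) (Fin n) 𝔽,
      (∀ k ℓ, M k ℓ ≠ 0 ↔ R k ℓ = true) ∧ M.rank = minRank 𝔽 R :=
  Nat.sInf_mem (s := {r | ∃ M : Matrix (Fin n) (Fin n) 𝔽,
    (∀ k ℓ, M k ℓ ≠ 0 ↔ R k ℓ = true) ∧ M.rank = r})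
    ⟨_, Matrix.of fun k ℓ => if R k ℓ = true then (1 : 𝔽) else 0, by simp, rfl⟩

theorem card_minRank_le (𝔽 : Type*) [Field 𝔽] (n r : ℕ) :
    Nat.card {R : Matrix (Fin n) (Fin n) Bool // minRank 𝔽 R ≤ r} ≤
      (n * r + r * n + n * n * 2).choose (n * n * 2) := by
  classical
  have key : ∀ R : {R : Matrix (Fin n) (Fin n) Bool // minRank 𝔽 R ≤ r},
      ∃ (A : Matrix (Fin n) (Fin r) 𝔽) (B : Matrix (Fin r) (Fin n) 𝔽),
        ∀ k ℓ, (A * B) k ℓ ≠ 0 ↔ R.1 k ℓ = true := by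
    rintro ⟨R, hR⟩
    obtain ⟨M, hM, hrank⟩ := exists_pattern_rank_eq_minRank (𝔽 := 𝔽) R
    obtain ⟨A, B, rfl⟩ := M.exists_eq_mul_of_rank_le (hrank.trans_le hR)
    exact ⟨A, B, hM⟩
  choose A B hAB using key
  have h := MvPolynomial.card_le_of_support_injective
    (σ := (Fin n × Fin r) ⊕ (Fin r × Fin n)) (F := 𝔽) (κ := Fin n × Fin n)
    (ι := {R : Matrix (Fin n) (Fin n) Bool // minRank 𝔽 R ≤ r}) (d := 2)
    (fun p => ∑ i, MvPolynomial.X (Sum.inl (p.1, i)) * MvPolynomial.X (Sum.inr (i, p.2)))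
    (fun p => MvPolynomial.totalDegree_finsetSum_le fun i _ =>
      (MvPolynomial.totalDegree_mul _ _).trans (by simp))
    (fun R => {p | R.1 p.1 p.2 = true})
    (fun R R' h => Subtype.ext <| by
      ext k ℓ
      have := Finset.ext_iff.1 h (k, ℓ)
      simpa [← Bool.eq_iff_iff] using this)
    (fun R => Sum.elim (fun q => A R q.1 q.2) (fun q => B R q.1 q.2))
    (fun R p => by simpa [Matrix.mul_apply] using hAB R p.1 p.2)
  simpa [Nat.card_eq_fintype_card] using h

theorem three_pow_choose_le_card_isFoolingPattern (n : ℕ) :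
    3 ^ n.choose 2 ≤ Nat.card {R : Matrix (Fin n) (Fin n) Bool // IsFoolingPattern R} := by
  classical
  have hcard : Nat.card ({p : Fin n × Fin n // p.1 < p.2} → Fin 3) = 3 ^ n.choose 2 := by
    rw [Nat.card_eq_fintype_card, Fintype.card_fun, Fintype.card_subtype,
      Fintype.card_product_filter_lt]
    simp
  rw [← hcard]
  refine Nat.card_le_card_of_injective (fun φ => ⟨Matrix.of fun k ℓ =>
    if h : k < ℓ then decide (φ ⟨(k, ℓ), h⟩ = 1)
    else if h : ℓ < k then decide (φ ⟨(ℓ, k), h⟩ = 2) else true, ?_, ?_⟩) ?_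
  · intro k
    simp
  · intro k ℓ hkℓ
    rcases lt_or_gt_of_ne hkℓ with h | h
    · simp only [Matrix.of_apply, h, h.not_gt, dite_true, dite_false, decide_eq_false_iff_not]
      by_contra! h'
      exact absurd (h'.1.symm.trans h'.2) (by decide)
    · simp only [Matrix.of_apply, h, h.not_gt, dite_true, dite_false, decide_eq_false_iff_not]
      by_contra! h'
      exact absurd (h'.1.symm.trans h'.2) (by decide)
  · intro φ ψ h
    funext ⟨⟨k, ℓ⟩, hkℓ⟩
    change k < ℓ at hkℓ
    have h1 := congrFun (congrFun (congrArg Subtype.val h) k) ℓ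
    have h2 := congrFun (congrFun (congrArg Subtype.val h) ℓ) k
    simp only [Matrix.of_apply, hkℓ, hkℓ.not_gt, dite_true, dite_false, decide_eq_decide] at h1 h2
    generalize φ ⟨(k, ℓ), hkℓ⟩ = a at *
    generalize ψ ⟨(k, ℓ), hkℓ⟩ = b at *
    revert a b
    decide

theorem choose_le_pow_of_mul_le {n r : ℕ} (hr : 50 * r ≤ n) :
    ((n * r + r * n + n * n * 2).choose (n * n * 2) : ℝ) ≤ (1.36 : ℝ) ^ (n * n) := by
  have h : ((n * r + r * n + n * n * 2).choose (n * n * 2) : ℝ) * 9 ^ (n * n * 2) ≤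
      10 ^ (n * r + r * n + n * n * 2) := by
    exact_mod_cast Nat.choose_add_mul_nine_pow_le (n * r + r * n) (n * n * 2)
  have h10 : (10 : ℝ) ^ (n * r + r * n) ≤ 1.1 ^ (n * n) := by
    calc (10 : ℝ) ^ (n * r + r * n) ≤ (1.1 ^ 25) ^ (n * r + r * n) := by
          gcongr; norm_num
      _ = 1.1 ^ (25 * (n * r + r * n)) := (pow_mul _ _ _).symm
      _ ≤ 1.1 ^ (n * n) := by
          refine pow_le_pow_right₀ (by norm_num) ?_
          nlinarith [Nat.mul_le_mul_left n hr]
  refine le_of_mul_le_mul_right (h.trans ?_) (show (0 : ℝ) < 9 ^ (n * n * 2) by positivity)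
  calc (10 : ℝ) ^ (n * r + r * n + n * n * 2) = 10 ^ (n * r + r * n) * 10 ^ (n * n * 2) :=
        pow_add _ _ _
    _ ≤ 1.1 ^ (n * n) * 10 ^ (n * n * 2) := by gcongr
    _ = (1.1 * 10 ^ 2) ^ (n * n) := by rw [mul_pow, ← pow_mul, mul_comm 2]
    _ ≤ (1.36 * 9 ^ 2) ^ (n * n) :=
        pow_le_pow_left₀ (by norm_num) (by norm_num) _
    _ = 1.36 ^ (n * n) * 9 ^ (n * n * 2) := by rw [mul_pow, ← pow_mul, mul_comm 2]

theorem pow_le_half_pow_mul_three_pow_choose {n : ℕ} (hn : 8 ≤ n) :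
    (1.36 : ℝ) ^ (n * n) ≤ (1 / 2) ^ n * 3 ^ n.choose 2 := by
  have h3 : (1.7 : ℝ) ^ (n * n) ≤ 1.7 ^ n * 3 ^ n.choose 2 := by
    have hc : n * n = n + 2 * n.choose 2 := by
      rw [Nat.choose_two_right, Nat.mul_div_cancel' (Nat.even_mul_pred_self n).two_dvd]
      obtain ⟨m, rfl⟩ : ∃ m, n = m + 1 := ⟨n - 1, by omega⟩
      simp; ring
    rw [hc, pow_add, pow_mul]
    gcongr
    norm_num
  have h8 : (0.8 : ℝ) ^ n * 1.7 ≤ 1 / 2 := by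
    have := pow_le_pow_of_le_one (show (0 : ℝ) ≤ 0.8 by norm_num) (by norm_num) hn
    norm_num at this ⊢
    linarith
  calc (1.36 : ℝ) ^ (n * n) = (0.8 ^ n) ^ n * 1.7 ^ (n * n) := by
        rw [← pow_mul, ← mul_pow]; norm_num
    _ ≤ (0.8 ^ n) ^ n * (1.7 ^ n * 3 ^ n.choose 2) := by gcongr
    _ = (0.8 ^ n * 1.7) ^ n * 3 ^ n.choose 2 := by rw [mul_pow, mul_assoc]
    _ ≤ (1 / 2) ^ n * 3 ^ n.choose 2 := by gcongr

theorem card_isFoolingPattern_le_add (𝔽 : Type*) [Field 𝔽] (n : ℕ) :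
    Nat.card {R : Matrix (Fin n) (Fin n) Bool // IsFoolingPattern R} ≤
      Nat.card {R : Matrix (Fin n) (Fin n) Bool //
        IsFoolingPattern R ∧ (1 / 50 : ℝ) * n ≤ (minRank 𝔽 R : ℝ)} +
      Nat.card {R : Matrix (Fin n) (Fin n) Bool // minRank 𝔽 R ≤ n / 50} := by
  classical
  simp only [Nat.card_eq_fintype_card, Fintype.card_subtype]
  refine le_trans (Finset.card_le_card fun R hR => ?_) (Finset.card_union_le _ _)
  simp only [Finset.mem_union, Finset.mem_filter, Finset.mem_univ, true_and] at hR ⊢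
  refine (le_or_gt ((1 / 50 : ℝ) * n) (minRank 𝔽 R)).imp (fun h => ⟨hR, h⟩) fun h => ?_
  rw [Nat.le_div_iff_mul_le (by norm_num)]
  have : (minRank 𝔽 R * 50 : ℝ) ≤ n := by linarith
  exact_mod_cast this

/-- Theorem 1(c), uniform version: for every field `𝔽`, a.a.s. the minimum rank of a
uniformly random fooling-set pattern `Q(n)` is `Ω(n)`. -/
theorem minRank_aas_linear_uniform (𝔽 : Type*) [Field 𝔽] :
    ∃ c : ℝ, 0 < c ∧
      Tendsto (fun n : ℕ =>
          (Nat.card {R : Matrix (Fin n) (Fin n) Bool //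
              IsFoolingPattern R ∧ c * n ≤ (minRank 𝔽 R : ℝ)} : ℝ) /
          (Nat.card {R : Matrix (Fin n) (Fin n) Bool // IsFoolingPattern R} : ℝ))
        atTop (nhds 1) := by
  refine ⟨1 / 50, by norm_num, ?_⟩
  have hlim : Tendsto (fun n : ℕ => 1 - (1 / 2 : ℝ) ^ n) atTop (nhds 1) := by
    simpa using (tendsto_pow_atTop_nhds_zero_of_lt_one
      (show (0 : ℝ) ≤ 1 / 2 by norm_num) (by norm_num)).const_sub 1
  refine tendsto_of_tendsto_of_tendsto_of_le_of_le' hlim tendsto_const_nhds ?_ ?_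
  · filter_upwards [eventually_ge_atTop 8] with n hn
    have htotal : (3 : ℝ) ^ n.choose 2 ≤
        (Nat.card {R : Matrix (Fin n) (Fin n) Bool // IsFoolingPattern R} : ℝ) := by
      exact_mod_cast three_pow_choose_le_card_isFoolingPattern n
    have hpos := (show (0 : ℝ) < 3 ^ n.choose 2 by positivity).trans_le htotal
    have hbad : (Nat.card {R : Matrix (Fin n) (Fin n) Bool // minRank 𝔽 R ≤ n / 50} : ℝ) ≤
        (1 / 2) ^ n *
          (Nat.card {R : Matrix (Fin n) (Fin n) Bool // IsFoolingPattern R} : ℝ) :=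
      calc _ ≤ _ := Nat.cast_le.2 (card_minRank_le 𝔽 n (n / 50))
        _ ≤ _ := choose_le_pow_of_mul_le (Nat.mul_div_le n 50)
        _ ≤ _ := pow_le_half_pow_mul_three_pow_choose hn
        _ ≤ _ := by gcongr
    have hsplit : (Nat.card {R : Matrix (Fin n) (Fin n) Bool // IsFoolingPattern R} : ℝ) ≤
        Nat.card {R : Matrix (Fin n) (Fin n) Bool //
          IsFoolingPattern R ∧ (1 / 50 : ℝ) * n ≤ (minRank 𝔽 R : ℝ)} +
        Nat.card {R : Matrix (Fin n) (Fin n) Bool // minRank 𝔽 R ≤ n / 50} := by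
      exact_mod_cast card_isFoolingPattern_le_add 𝔽 n
    rw [le_div_iff₀ hpos]
    linarith
  · refine Eventually.of_forall fun n => div_le_one_of_le₀ ?_ (Nat.cast_nonneg _)
    exact_mod_cast Nat.card_le_card_of_injective
      (Subtype.map id fun R (hR : IsFoolingPattern R ∧ _) => hR.1)
      (Subtype.map_injective _ Function.injective_id)
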